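/- arXiv:2506.06486 — 2 statements merged into one kernel-verified Lean document; each statement's English description precedes it below -/
import Mathlib

section
/- Let H_D, H_{D_s}, H_{D_u} be real symmetric d × d matrices each satisfying α • I ⪯ H ⪯ β • I with 0 < α ≤ β, let n₁ ≥ n₂ > 0 and m > 0 be real numbers with n₁ α > m β and n₂ α > m β, let τ ≥ 0, and suppose ‖n₁ • H_D − n₂ • H_{D_s}‖ ≤ (n₁ − n₂) β + 2 n₂ β τ. Then for every vector g ∈ ℝᵈ, ‖m • (n₁ • H_D − m • H_{D_u})⁻¹ g − m • (n₂ • H_{D_s} − m • H_{D_u})⁻¹ g‖ ≤ ((m (n₁ − n₂) β + 2 m n₂ β τ) / ((n₁ α − m β)(n₂ α − m β))) · ‖g‖. -/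
/-- The operator (spectral) norm of a real `d × d` matrix, i.e. the norm of the
associated linear map on Euclidean space. -/
noncomputable def matOpNorm {d : ℕ} (A : Matrix (Fin d) (Fin d) ℝ) : ℝ :=
  ‖LinearMap.toContinuousLinearMap (Matrix.toEuclideanLin A)‖

namespace Matrix

variable {n : Type*} [DecidableEq n]

theorem posSemidef_smul_sub_smul_sub {H K : Matrix n n ℝ} {α β a b : ℝ} (ha : 0 ≤ a)
    (hb : 0 ≤ b) (hH : (H - α • (1 : Matrix n n ℝ)).PosSemidef)
    (hK : (β • (1 : Matrix n n ℝ) - K).PosSemidef) :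
    (a • H - b • K - (a * α - b * β) • (1 : Matrix n n ℝ)).PosSemidef := by
  convert (hH.smul ha).add (hK.smul hb) using 1
  module

variable [Fintype n]

theorem norm_le_norm_toEuclideanLin_of_posSemidef_sub {A : Matrix n n ℝ} {c : ℝ}
    (hA : (A - c • (1 : Matrix n n ℝ)).PosSemidef) (x : EuclideanSpace ℝ n) :
    c * ‖x‖ ≤ ‖toEuclideanLin A x‖ := by
  have hinner : c * (‖x‖ * ‖x‖) ≤ inner ℝ x (toEuclideanLin A x) := by
    have h := hA.dotProduct_mulVec_nonneg x.ofLp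
    rw [star_trivial, ← inner_toEuclideanCLM] at h
    simp only [map_sub, map_smul, map_one, _root_.sub_apply, _root_.smul_apply,
      one_apply_eq_self, inner_sub_right,
      inner_smul_right, real_inner_self_eq_norm_mul_norm] at h
    have h' : toEuclideanCLM (n := n) (𝕜 := ℝ) A x = toEuclideanLin A x := rfl
    rw [h'] at h
    linarith
  rcases (norm_nonneg x).eq_or_lt with hx | hx
  · simp [← hx]
  · have := real_inner_le_norm x (toEuclideanLin A x)
    exact le_of_mul_le_mul_left (by linarith) hx

theorem isUnit_of_posSemidef_sub {A : Matrix n n ℝ} {c : ℝ} (hc : 0 < c)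
    (hA : (A - c • (1 : Matrix n n ℝ)).PosSemidef) : IsUnit A := by
  have h := (PosDef.one.smul hc).add_posSemidef hA
  rw [add_sub_cancel] at h
  exact h.isUnit

theorem toEuclideanLin_mul_apply (A B : Matrix n n ℝ) (x : EuclideanSpace ℝ n) :
    toEuclideanLin (A * B) x = toEuclideanLin A (toEuclideanLin B x) := by
  simp [toEuclideanLin]

theorem norm_toEuclideanLin_inv_le {A : Matrix n n ℝ} {c : ℝ} (hc : 0 < c)
    (hA : (A - c • (1 : Matrix n n ℝ)).PosSemidef) (x : EuclideanSpace ℝ n) :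
    ‖toEuclideanLin A⁻¹ x‖ ≤ ‖x‖ / c := by
  have h := norm_le_norm_toEuclideanLin_of_posSemidef_sub hA (toEuclideanLin A⁻¹ x)
  rw [← toEuclideanLin_mul_apply, mul_nonsing_inv _
    ((isUnit_iff_isUnit_det A).mp (isUnit_of_posSemidef_sub hc hA))] at h
  rw [le_div_iff₀' hc]
  simpa [toEuclideanLin] using h

end Matrix

theorem norm_toEuclideanLin_le_matOpNorm_mul {d : ℕ} (A : Matrix (Fin d) (Fin d) ℝ)
    (x : EuclideanSpace ℝ (Fin d)) : ‖Matrix.toEuclideanLin A x‖ ≤ matOpNorm A * ‖x‖ :=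
  (LinearMap.toContinuousLinearMap (Matrix.toEuclideanLin A)).le_opNorm x

/-- **Lemma C.4.** For symmetric matrices `H_D, H_{D_s}, H_{D_u}` sandwiched between
`α • I` and `β • I` (with `0 < α ≤ β`), real `n₁ ≥ n₂ > 0`, `m > 0` such that
`n₁ α > m β` and `n₂ α > m β`, `τ ≥ 0`, and assuming
`‖n₁ • H_D - n₂ • H_{D_s}‖ ≤ (n₁ - n₂) β + 2 n₂ β τ`, for every vector `g`,
`‖m • (n₁ • H_D - m • H_{D_u})⁻¹ g - m • (n₂ • H_{D_s} - m • H_{D_u})⁻¹ g‖`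
is at most `((m (n₁ - n₂) β + 2 m n₂ β τ) / ((n₁ α - m β)(n₂ α - m β))) ‖g‖`. -/
theorem stmt_3 {d : ℕ} (HD HDs HDu : Matrix (Fin d) (Fin d) ℝ) (α β n₁ n₂ m τ : ℝ)
    (hα : 0 < α) (hαβ : α ≤ β) (hn₂ : 0 < n₂) (hn : n₂ ≤ n₁) (hm : 0 < m) (hτ : 0 ≤ τ)
    (hHDsymm : HD.IsSymm) (hHDssymm : HDs.IsSymm) (hHDusymm : HDu.IsSymm)
    (hHD_lo : (HD - α • (1 : Matrix (Fin d) (Fin d) ℝ)).PosSemidef)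
    (hHD_hi : ((β • (1 : Matrix (Fin d) (Fin d) ℝ)) - HD).PosSemidef)
    (hHDs_lo : (HDs - α • (1 : Matrix (Fin d) (Fin d) ℝ)).PosSemidef)
    (hHDs_hi : ((β • (1 : Matrix (Fin d) (Fin d) ℝ)) - HDs).PosSemidef)
    (hHDu_lo : (HDu - α • (1 : Matrix (Fin d) (Fin d) ℝ)).PosSemidef)
    (hHDu_hi : ((β • (1 : Matrix (Fin d) (Fin d) ℝ)) - HDu).PosSemidef)
    (h₁ : m * β < n₁ * α) (h₂ : m * β < n₂ * α)
    (hdiff : matOpNorm (n₁ • HD - n₂ • HDs) ≤ (n₁ - n₂) * β + 2 * n₂ * β * τ)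
    (g : EuclideanSpace ℝ (Fin d)) :
    ‖m • Matrix.toEuclideanLin ((n₁ • HD - m • HDu)⁻¹) g -
        m • Matrix.toEuclideanLin ((n₂ • HDs - m • HDu)⁻¹) g‖ ≤
      ((m * (n₁ - n₂) * β + 2 * m * n₂ * β * τ) /
        ((n₁ * α - m * β) * (n₂ * α - m * β))) * ‖g‖ := by
  have hc₁ : 0 < n₁ * α - m * β := sub_pos.2 h₁
  have hc₂ : 0 < n₂ * α - m * β := sub_pos.2 h₂
  have hA := Matrix.posSemidef_smul_sub_smul_sub (hn₂.le.trans hn) hm.le hHD_lo hHDu_hi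
  have hB := Matrix.posSemidef_smul_sub_smul_sub hn₂.le hm.le hHDs_lo hHDu_hi
  have hresolvent := Matrix.inv_sub_inv <| iff_of_true
    (Matrix.isUnit_of_posSemidef_sub hc₂ hB) (Matrix.isUnit_of_posSemidef_sub hc₁ hA)
  rw [sub_sub_sub_cancel_right] at hresolvent
  rw [norm_sub_rev, ← smul_sub, ← LinearMap.sub_apply, ← map_sub, hresolvent,
    Matrix.toEuclideanLin_mul_apply, Matrix.toEuclideanLin_mul_apply, norm_smul,
    Real.norm_of_nonneg hm.le]
  set y := Matrix.toEuclideanLin (n₁ • HD - m • HDu)⁻¹ g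
  have hbound : 0 ≤ (n₁ - n₂) * β + 2 * n₂ * β * τ := (norm_nonneg _).trans hdiff
  calc m * ‖Matrix.toEuclideanLin (n₂ • HDs - m • HDu)⁻¹
          (Matrix.toEuclideanLin (n₁ • HD - n₂ • HDs) y)‖
      ≤ m * (‖Matrix.toEuclideanLin (n₁ • HD - n₂ • HDs) y‖ / (n₂ * α - m * β)) := by
        gcongr
        exact Matrix.norm_toEuclideanLin_inv_le hc₂ hB _
    _ ≤ m * (((n₁ - n₂) * β + 2 * n₂ * β * τ) * (‖g‖ / (n₁ * α - m * β)) /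
          (n₂ * α - m * β)) := by
        gcongr
        refine (norm_toEuclideanLin_le_matOpNorm_mul _ y).trans ?_
        gcongr
        exact Matrix.norm_toEuclideanLin_inv_le hc₁ hA g
    _ = _ := by
        field_simp
end

section
/- Let P and Q be probability mass functions on a finite type Z such that Q is absolutely continuous with respect to P (P(z) = 0 implies Q(z) = 0). Then the total variation distance satisfies TV(P, Q) ≤ √(1 − exp(−KL(Q ‖ P))). -/
/-- The total variation distance between two probability mass functions on a finite type. -/
noncomputable def tvDist {Z : Type*} [Fintype Z] (P Q : Z → ℝ) : ℝ :=
  (1 / 2) * ∑ z, |P z - Q z|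

/-- The Kullback–Leibler divergence `KL(Q ‖ P)` between two probability mass functions
on a finite type, summing over the support of `Q`. -/
noncomputable def klDiv {Z : Type*} [Fintype Z] (Q P : Z → ℝ) : ℝ :=
  ∑ z ∈ Finset.univ.filter fun z => 0 < Q z, Q z * Real.log (Q z / P z)

/-- By Cauchy–Schwarz, `(∑ √(P Q))² + TV(P, Q)² ≤ 1`. -/
theorem sq_sum_sqrt_mul_add_tvDist_sq_le_one {Z : Type*} [Fintype Z] (P Q : Z → ℝ)
    (hP0 : ∀ z, 0 ≤ P z) (hP1 : ∑ z, P z = 1)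
    (hQ0 : ∀ z, 0 ≤ Q z) (hQ1 : ∑ z, Q z = 1) :
    (∑ z, √(P z * Q z)) ^ 2 + tvDist P Q ^ 2 ≤ 1 := by
  have hadd : ∑ z, min (P z) (Q z) + ∑ z, max (P z) (Q z) = 2 := by
    simp only [← Finset.sum_add_distrib, min_add_max]
    rw [Finset.sum_add_distrib, hP1, hQ1]
    norm_num
  have hsub : ∑ z, max (P z) (Q z) - ∑ z, min (P z) (Q z) = 2 * tvDist P Q := by
    simp only [← Finset.sum_sub_distrib, max_sub_min_eq_abs', tvDist]
    ring
  have hmin : ∑ z, min (P z) (Q z) = 1 - tvDist P Q := by linarith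
  have hmax : ∑ z, max (P z) (Q z) = 1 + tvDist P Q := by linarith
  have h := Finset.sum_sq_le_sum_mul_sum_of_sq_le_mul Finset.univ
    (r := fun z => √(P z * Q z)) (f := fun z => min (P z) (Q z)) (g := fun z => max (P z) (Q z))
    (fun z _ => le_min (hP0 z) (hQ0 z)) (fun z _ => le_max_of_le_left (hP0 z))
    (fun z _ => by rw [Real.sq_sqrt (mul_nonneg (hP0 z) (hQ0 z)), min_mul_max])
  rw [hmin, hmax] at h
  linarith

/-- By Jensen's inequality, `exp (-KL(Q ‖ P)) ≤ (∑ √(P Q))²`. -/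
theorem exp_neg_klDiv_le_sq_sum_sqrt_mul {Z : Type*} [Fintype Z] (P Q : Z → ℝ)
    (hP0 : ∀ z, 0 ≤ P z) (hQ0 : ∀ z, 0 ≤ Q z) (hQ1 : ∑ z, Q z = 1)
    (hAC : ∀ z, P z = 0 → Q z = 0) :
    Real.exp (-(klDiv Q P)) ≤ (∑ z, √(P z * Q z)) ^ 2 := by
  have hsupp (f : Z → ℝ) (hf : ∀ z, Q z = 0 → f z = 0) :
      ∑ z ∈ Finset.univ.filter (fun z => 0 < Q z), f z = ∑ z, f z :=
    Finset.sum_filter_of_ne fun z _ hz => (hQ0 z).lt_of_ne' (mt (hf z) hz)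
  have hJensen := convexOn_exp.map_sum_le (t := Finset.univ.filter fun z => 0 < Q z)
    (w := Q) (p := fun z => -Real.log (Q z / P z) / 2) (fun z _ => hQ0 z)
    ((hsupp Q fun _ h => h).trans hQ1) (fun _ _ => Set.mem_univ _)
  have hterm : ∀ z ∈ Finset.univ.filter (fun z => 0 < Q z),
      Q z • Real.exp (-Real.log (Q z / P z) / 2) = √(P z * Q z) := by
    intro z hz
    have hQ : 0 < Q z := (Finset.mem_filter.mp hz).2
    have hP : 0 < P z := (hP0 z).lt_of_ne' fun h => hQ.ne' (hAC z h)
    rw [← Real.log_inv, inv_div, Real.exp_half, Real.exp_log (by positivity), smul_eq_mul,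
      eq_comm, Real.sqrt_eq_iff_mul_self_eq (by positivity) (by positivity),
      mul_mul_mul_comm, Real.mul_self_sqrt (by positivity)]
    field_simp
  have hexp : ∑ z ∈ Finset.univ.filter (fun z => 0 < Q z),
      Q z • (-Real.log (Q z / P z) / 2) = -(klDiv Q P) / 2 := by
    rw [klDiv, ← Finset.sum_neg_distrib, Finset.sum_div]
    exact Finset.sum_congr rfl fun z _ => by rw [smul_eq_mul]; ring
  rw [Finset.sum_congr rfl hterm, hexp, Real.exp_half,
    hsupp _ fun z h => by simp [h]] at hJensen
  exact (Real.sqrt_le_left (by positivity)).mp hJensen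

/-- **Bretagnolle–Huber inequality.** For probability mass functions `P, Q` on a finite
type with `Q` absolutely continuous with respect to `P`,
`TV(P, Q) ≤ √(1 - exp(-KL(Q ‖ P)))`. -/
theorem stmt_7 {Z : Type*} [Fintype Z] (P Q : Z → ℝ)
    (hP0 : ∀ z, 0 ≤ P z) (hP1 : ∑ z, P z = 1)
    (hQ0 : ∀ z, 0 ≤ Q z) (hQ1 : ∑ z, Q z = 1)
    (hAC : ∀ z, P z = 0 → Q z = 0) :
    tvDist P Q ≤ Real.sqrt (1 - Real.exp (-(klDiv Q P))) := by
  apply Real.le_sqrt_of_sq_le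
  linarith [sq_sum_sqrt_mul_add_tvDist_sq_le_one P Q hP0 hP1 hQ0 hQ1,
    exp_neg_klDiv_le_sq_sum_sqrt_mul P Q hP0 hQ0 hQ1 hAC]
end
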